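/- Let $0\le\rho<1$ and $m\in\mathbb{R}$, and let $a\in\mathcal{S}^m_{\rho,\rho}$. Let $\phi_j(x)=2^{jd}\phi(2^j x)$ where $\phi$ is a Schwartz function whose Fourier transform is supported in $\{\xi: 1/2\le|\xi|\le 2\}$ (so $\int \phi(y)\,y^\beta\,dy=0$ for all multi-indices $\beta$ with $|\beta|<N$). Then for every positive integer $N$, every multi-index $\alpha$, every $j\ge 1$, every $k\ge 0$, and all $x\in\mathbb{R}^d$, $|\xi|\sim 1$: $|\phi_j\ast(\partial_\xi^\alpha a(\cdot,2^k\xi))(x)|\le C_{N,\alpha}\,2^{k(m-\rho|\alpha|+\rho N)}\,2^{-jN}$. -/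

import Mathlib

open MeasureTheory Real Complex Filter
open scoped FourierTransform ENNReal NNReal

noncomputable section

abbrev Ed (d : ℕ) := EuclideanSpace ℝ (Fin d)

/-- Partial derivative in the first (`x`) variable, direction `i`. -/
noncomputable def pdX (d : ℕ) (i : Fin d) (a : Ed d → Ed d → ℂ) : Ed d → Ed d → ℂ :=
  fun x ξ => fderiv ℝ (fun x' => a x' ξ) x (EuclideanSpace.single i 1)

/-- Partial derivative in the second (`ξ`) variable, direction `i`. -/
noncomputable def pdXi (d : ℕ) (i : Fin d) (a : Ed d → Ed d → ℂ) : Ed d → Ed d → ℂ :=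
  fun x ξ => fderiv ℝ (fun ξ' => a x ξ') ξ (EuclideanSpace.single i 1)

/-- Iterated `x`-derivatives `∂_x^β` along a list of coordinate directions. -/
noncomputable def pdXs (d : ℕ) : List (Fin d) → (Ed d → Ed d → ℂ) → Ed d → Ed d → ℂ
  | [], a => a
  | i :: L, a => pdX d i (pdXs d L a)

/-- Iterated `ξ`-derivatives `∂_ξ^α` along a list of coordinate directions. -/
noncomputable def pdXis (d : ℕ) : List (Fin d) → (Ed d → Ed d → ℂ) → Ed d → Ed d → ℂ
  | [], a => a
  | i :: L, a => pdXi d i (pdXis d L a)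

/-- Hörmander symbol class `S^m_{ρ,δ}`. -/
def IsSymbol (d : ℕ) (m ρ δ : ℝ) (a : Ed d → Ed d → ℂ) : Prop :=
  ContDiff ℝ (⊤ : ℕ∞) (fun p : Ed d × Ed d => a p.1 p.2) ∧
  ∀ (α β : List (Fin d)), ∃ C : ℝ, ∀ (x ξ : Ed d),
    ‖pdXis d α (pdXs d β a) x ξ‖ ≤ C * (1 + ‖ξ‖) ^ (m - ρ * α.length + δ * β.length)

def Sm (d : ℕ) (a : Ed d → Ed d → ℂ) : Prop :=
  ContDiff ℝ (⊤ : ℕ∞) (fun p : Ed d × Ed d => a p.1 p.2)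

lemma pdX_eq {d : ℕ} {a : Ed d → Ed d → ℂ} (ha : Sm d a) (i : Fin d) (x ξ : Ed d) :
    pdX d i a x ξ = fderiv ℝ (fun p : Ed d × Ed d => a p.1 p.2) (x, ξ)
      (EuclideanSpace.single i 1, 0) := by
  have h1 : HasFDerivAt (fun p : Ed d × Ed d => a p.1 p.2) _ (x, ξ) :=
    ((ContDiff.differentiable ha (by simp)) (x, ξ)).hasFDerivAt
  have h2 := HasFDerivAt.comp (𝕜 := ℝ) (f := fun e : Ed d => (e, ξ)) x h1 (hasFDerivAt_prodMk_left x ξ)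
  have h3 : HasFDerivAt (fun x' => a x' ξ) _ x := h2
  rw [pdX, h3.fderiv]
  simp

lemma pdXi_eq {d : ℕ} {a : Ed d → Ed d → ℂ} (ha : Sm d a) (i : Fin d) (x ξ : Ed d) :
    pdXi d i a x ξ = fderiv ℝ (fun p : Ed d × Ed d => a p.1 p.2) (x, ξ)
      (0, EuclideanSpace.single i 1) := by
  have h1 : HasFDerivAt (fun p : Ed d × Ed d => a p.1 p.2) _ (x, ξ) :=
    ((ContDiff.differentiable ha (by simp)) (x, ξ)).hasFDerivAt
  have h2 := HasFDerivAt.comp (𝕜 := ℝ) (f := fun e : Ed d => (x, e)) ξ h1 (hasFDerivAt_prodMk_right x ξ)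
  have h3 : HasFDerivAt (fun ξ' => a x ξ') _ ξ := h2
  rw [pdXi, h3.fderiv]
  simp

lemma Sm_dir {d : ℕ} {a : Ed d → Ed d → ℂ} (ha : Sm d a) (v : Ed d × Ed d) :
    ContDiff ℝ (⊤ : ℕ∞) (fun p => fderiv ℝ (fun p : Ed d × Ed d => a p.1 p.2) p v) :=
  (ContDiff.fderiv_right ha (by simp)).clm_apply contDiff_const

lemma Sm_pdX {d : ℕ} {a : Ed d → Ed d → ℂ} (ha : Sm d a) (i : Fin d) : Sm d (pdX d i a) := by
  unfold Sm
  simp only [pdX_eq ha]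
  exact Sm_dir ha _

lemma Sm_pdXi {d : ℕ} {a : Ed d → Ed d → ℂ} (ha : Sm d a) (i : Fin d) : Sm d (pdXi d i a) := by
  unfold Sm
  simp only [pdXi_eq ha]
  exact Sm_dir ha _

lemma Sm_pdXis {d : ℕ} {a : Ed d → Ed d → ℂ} (ha : Sm d a) (L : List (Fin d)) :
    Sm d (pdXis d L a) := by
  induction L with
  | nil => exact ha
  | cons i L ih => exact Sm_pdXi ih i

lemma Sm_pdXs {d : ℕ} {a : Ed d → Ed d → ℂ} (ha : Sm d a) (L : List (Fin d)) :
    Sm d (pdXs d L a) := by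
  induction L with
  | nil => exact ha
  | cons i L ih => exact Sm_pdX ih i

lemma fderiv_dir {d : ℕ} {a : Ed d → Ed d → ℂ} (ha : Sm d a) (v w p : Ed d × Ed d) :
    fderiv ℝ (fun p => fderiv ℝ (fun p : Ed d × Ed d => a p.1 p.2) p v) p w =
      fderiv ℝ (fderiv ℝ (fun p : Ed d × Ed d => a p.1 p.2)) p w v := by
  have h : DifferentiableAt ℝ (fderiv ℝ (fun p : Ed d × Ed d => a p.1 p.2)) p :=
    (ContDiff.fderiv_right (m := (⊤ : ℕ∞)) ha (by simp)).differentiable (by simp) p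
  rw [fderiv_clm_apply h (by fun_prop)]
  simp

lemma pdX_pdXi_comm {d : ℕ} {a : Ed d → Ed d → ℂ} (ha : Sm d a) (i j : Fin d) :
    pdX d i (pdXi d j a) = pdXi d j (pdX d i a) := by
  funext x ξ
  rw [pdX_eq (Sm_pdXi ha j), pdXi_eq (Sm_pdX ha i)]
  simp only [pdX_eq ha, pdXi_eq ha, Prod.mk.eta]
  rw [fderiv_dir ha, fderiv_dir ha]
  apply ContDiffAt.isSymmSndFDerivAt (n := (⊤ : ℕ∞)) (ContDiff.contDiffAt ha)
  rw [minSmoothness_of_isRCLikeNormedField]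
  exact WithTop.coe_le_coe.mpr (le_top : (2 : ℕ∞) ≤ ⊤)

lemma pdX_pdXis_comm {d : ℕ} {a : Ed d → Ed d → ℂ} (ha : Sm d a) (i : Fin d)
    (L : List (Fin d)) : pdX d i (pdXis d L a) = pdXis d L (pdX d i a) := by
  induction L with
  | nil => rfl
  | cons j L ih =>
    simp only [pdXis]
    rw [pdX_pdXi_comm (Sm_pdXis ha L), ih]

lemma pdXs_pdXis_comm {d : ℕ} {a : Ed d → Ed d → ℂ} (ha : Sm d a) (α β : List (Fin d)) :
    pdXs d β (pdXis d α a) = pdXis d α (pdXs d β a) := by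
  induction β with
  | nil => rfl
  | cons j L ih =>
    simp only [pdXs]
    rw [ih, pdX_pdXis_comm (Sm_pdXs ha L)]

/-- One-variable partial derivative. -/
def D1 (d : ℕ) (i : Fin d) (g : Ed d → ℂ) : Ed d → ℂ :=
  fun x => fderiv ℝ g x (EuclideanSpace.single i 1)

/-- Iterated one-variable partial derivative. -/
def Ds (d : ℕ) : List (Fin d) → (Ed d → ℂ) → Ed d → ℂ
  | [], g => g
  | i :: L, g => D1 d i (Ds d L g)

lemma Ds_concat {d : ℕ} (L : List (Fin d)) (i : Fin d) (g : Ed d → ℂ) :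
    Ds d (L ++ [i]) g = Ds d L (D1 d i g) := by
  induction L with
  | nil => rfl
  | cons j L ih => simp [Ds, ih]

lemma pdXs_eq_Ds {d : ℕ} (L : List (Fin d)) (b : Ed d → Ed d → ℂ) (ξ : Ed d) :
    (fun x => pdXs d L b x ξ) = Ds d L (fun x => b x ξ) := by
  induction L with
  | nil => rfl
  | cons j L ih =>
    funext x
    simp only [pdXs, Ds, pdX, D1]
    rw [ih]

lemma D1_smooth {d : ℕ} {g : Ed d → ℂ} (hg : ContDiff ℝ (⊤ : ℕ∞) g) (i : Fin d) :
    ContDiff ℝ (⊤ : ℕ∞) (D1 d i g) :=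
  (ContDiff.fderiv_right hg (by simp)).clm_apply contDiff_const

lemma line_smooth {d : ℕ} {g : Ed d → ℂ} (hg : ContDiff ℝ (⊤ : ℕ∞) g) (x v : Ed d) :
    ContDiff ℝ (⊤ : ℕ∞) (fun t : ℝ => g (x + t • v)) :=
  hg.comp (contDiff_const.add (contDiff_id.smul contDiff_const))

lemma deriv_line {d : ℕ} {g : Ed d → ℂ} (hg : ContDiff ℝ (⊤ : ℕ∞) g) (x v : Ed d) :
    deriv (fun t : ℝ => g (x + t • v)) = fun t => ∑ i, v i • D1 d i g (x + t • v) := by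
  funext t
  have h1 : HasDerivAt (fun t : ℝ => x + t • v) v t := by
    simpa using ((hasDerivAt_id t).smul_const v).const_add x
  have h2 := ((hg.differentiable (by simp)) (x + t • v)).hasFDerivAt.comp_hasDerivAt t h1
  have h3 : HasDerivAt (fun t : ℝ => g (x + t • v)) (fderiv ℝ g (x + t • v) v) t := h2
  rw [h3.deriv]
  have hv : v = ∑ i, v i • EuclideanSpace.single i (1 : ℝ) := by
    have := (EuclideanSpace.basisFun (Fin d) ℝ).sum_repr v
    simpa using this.symm
  conv_lhs => rw [hv]
  simp only [map_sum, map_smul, D1]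
  rw [← hv]

lemma iter_line {d : ℕ} {g : Ed d → ℂ} (hg : ContDiff ℝ (⊤ : ℕ∞) g) (x v : Ed d) (n : ℕ) (t : ℝ) :
    iteratedDeriv (n + 1) (fun t : ℝ => g (x + t • v)) t =
      ∑ i, v i • iteratedDeriv n (fun t : ℝ => D1 d i g (x + t • v)) t := by
  rw [iteratedDeriv_succ', deriv_line hg, iteratedDeriv_fun_sum]
  · simp
  · intro i _
    exact ((line_smooth (D1_smooth hg i) x v).const_smul (v i)).contDiffAt.of_le
      (by exact_mod_cast le_top)

lemma iter_bound {d : ℕ} (n : ℕ) : ∀ (g : Ed d → ℂ), ContDiff ℝ (⊤ : ℕ∞) g → ∀ (M : ℝ),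
    (∀ L : List (Fin d), L.length = n → ∀ x, ‖Ds d L g x‖ ≤ M) → ∀ (x v : Ed d) (t : ℝ),
    ‖iteratedDeriv n (fun t : ℝ => g (x + t • v)) t‖ ≤ (d * ‖v‖) ^ n * M := by
  induction n with
  | zero =>
    intro g hg M hM x v t
    simpa [Ds] using hM [] rfl (x + t • v)
  | succ n ih =>
    intro g hg M hM x v t
    rw [iter_line hg]
    have key : ∀ i : Fin d, ‖v i • iteratedDeriv n (fun t : ℝ => D1 d i g (x + t • v)) t‖ ≤
        ‖v‖ * ((d * ‖v‖) ^ n * M) := by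
      intro i
      rw [norm_smul]
      have := ih (D1 d i g) (D1_smooth hg i) M (fun L hL y => by
        rw [← Ds_concat]; exact hM _ (by simp [hL]) y) x v t
      exact mul_le_mul (PiLp.norm_apply_le v i) this (norm_nonneg _) (norm_nonneg _)
    calc _ ≤ ∑ i : Fin d, ‖v‖ * ((d * ‖v‖) ^ n * M) := norm_sum_le_of_le _ (fun i _ => key i)
      _ = _ := by simp; ring

/-- Fourier transform vanishing near the origin. -/
def FVan {d : ℕ} (φ : SchwartzMap (Ed d) ℂ) : Prop :=
  ∀ᶠ ξ in nhds (0 : Ed d), 𝓕 φ ξ = 0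

/-- Multiplication by a coordinate. -/
def cmul {d : ℕ} (i : Fin d) (φ : SchwartzMap (Ed d) ℂ) : SchwartzMap (Ed d) ℂ :=
  SchwartzMap.smulLeftCLM ℂ (fun x : Ed d => inner ℝ x (EuclideanSpace.single i (1 : ℝ))) φ

lemma cmul_apply {d : ℕ} (i : Fin d) (φ : SchwartzMap (Ed d) ℂ) (x : Ed d) :
    cmul i φ x = (x i : ℂ) * φ x := by
  have : (fun x : Ed d => inner ℝ x (EuclideanSpace.single i (1 : ℝ))).HasTemperateGrowth := by
    fun_prop
  rw [cmul, SchwartzMap.smulLeftCLM_apply_apply this]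
  simp [EuclideanSpace.inner_single_right]

open LineDeriv in
lemma FVan_cmul {d : ℕ} {φ : SchwartzMap (Ed d) ℂ} (h : FVan φ) (i : Fin d) :
    FVan (cmul i φ) := by
  have h2 := SchwartzMap.lineDerivOp_fourier_eq φ (EuclideanSpace.single i (1 : ℝ))
  have h3 : ∀ᶠ ξ in nhds (0 : Ed d), ∀ᶠ η in nhds ξ, 𝓕 φ η = 0 := h.eventually_nhds
  refine h3.mono fun ξ hξ => ?_
  have h4 : fderiv ℝ (𝓕 φ : SchwartzMap (Ed d) ℂ) ξ = 0 := by
    have : (⇑(𝓕 φ : SchwartzMap (Ed d) ℂ)) =ᶠ[nhds ξ] fun _ => 0 := hξ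
    rw [this.fderiv_eq]; simp
  have h5 := congrArg (fun f : SchwartzMap (Ed d) ℂ => f ξ) h2
  simp only [SchwartzMap.lineDerivOp_apply_eq_fderiv, h4, FourierTransform.fourier_smul] at h5
  have h6 : (2 * (π : ℂ) * Complex.I) ≠ 0 := by simp [Real.pi_ne_zero]
  have h7 : (0 : ℂ) = -(2 * (π : ℂ) * Complex.I) * (𝓕 (cmul i φ)) ξ := h5
  exact (mul_eq_zero.mp h7.symm).resolve_left (neg_ne_zero.mpr h6)

lemma FVan_integral {d : ℕ} {φ : SchwartzMap (Ed d) ℂ} (h : FVan φ) : ∫ u, φ u = 0 := by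
  have h1 : 𝓕 φ 0 = 0 := h.self_of_nhds
  rw [SchwartzMap.fourier_coe, Real.fourier_eq] at h1
  simpa using h1

lemma moment {d : ℕ} (c : ℝ) (x : Ed d) (n : ℕ) : ∀ (g : Ed d → ℂ), ContDiff ℝ (⊤ : ℕ∞) g →
    ∀ φ : SchwartzMap (Ed d) ℂ, FVan φ →
    Integrable (fun u => φ u * iteratedDeriv n (fun t : ℝ => g (x + t • (c • u))) 0) ∧
    ∫ u, φ u * iteratedDeriv n (fun t : ℝ => g (x + t • (c • u))) 0 = 0 := by
  induction n with
  | zero =>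
    intro g hg φ hφ
    simp only [iteratedDeriv_zero, zero_smul, add_zero]
    refine ⟨φ.integrable.mul_const _, ?_⟩
    rw [integral_mul_const, FVan_integral hφ, zero_mul]
  | succ n ih =>
    intro g hg φ hφ
    have e : (fun u => φ u * iteratedDeriv (n + 1) (fun t : ℝ => g (x + t • (c • u))) 0) =
        fun u => ∑ i, (c : ℂ) * (cmul i φ u *
          iteratedDeriv n (fun t : ℝ => D1 d i g (x + t • (c • u))) 0) := by
      funext u
      rw [iter_line hg, Finset.mul_sum]
      refine Finset.sum_congr rfl fun i _ => ?_
      rw [cmul_apply, Complex.real_smul]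
      simp only [PiLp.smul_apply, smul_eq_mul, Complex.ofReal_mul]
      ring
    have H := fun i => ih (D1 d i g) (D1_smooth hg i) (cmul i φ) (FVan_cmul hφ i)
    rw [e]
    refine ⟨integrable_finsetSum _ fun i _ => (H i).1.const_mul _, ?_⟩
    rw [integral_finsetSum _ fun i _ => (H i).1.const_mul _]
    refine Finset.sum_eq_zero fun i _ => ?_
    rw [integral_const_mul, (H i).2, mul_zero]

lemma taylor_line {d : ℕ} (n : ℕ) (g : Ed d → ℂ) (hg : ContDiff ℝ (⊤ : ℕ∞) g) (M : ℝ)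
    (hM : ∀ L : List (Fin d), L.length = n + 1 → ∀ x, ‖Ds d L g x‖ ≤ M) (x v : Ed d) :
    ‖g (x + v) - ∑ k ∈ Finset.range (n + 1), ((k.factorial : ℝ)⁻¹ : ℂ) *
      iteratedDeriv k (fun t : ℝ => g (x + t • v)) 0‖ ≤ (d * ‖v‖) ^ (n + 1) * M := by
  have hs := line_smooth hg x v
  have hk : ∀ (k : ℕ) (t : ℝ), t ∈ Set.Icc (0 : ℝ) 1 →
      iteratedDerivWithin k (fun t : ℝ => g (x + t • v)) (Set.Icc 0 1) t =
        iteratedDeriv k (fun t : ℝ => g (x + t • v)) t := fun k t ht =>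
    iteratedDerivWithin_eq_iteratedDeriv (uniqueDiffOn_Icc zero_lt_one)
      (hs.contDiffAt.of_le (by exact_mod_cast le_top)) ht
  have := taylor_mean_remainder_bound (f := fun t : ℝ => g (x + t • v)) (a := 0) (b := 1)
    (x := 1) (n := n) (C := (d * ‖v‖) ^ (n + 1) * M) zero_le_one
    (hs.contDiffOn.of_le (by exact_mod_cast le_top)) (by simp)
    (fun y hy => by rw [hk _ _ hy]; exact iter_bound (n + 1) g hg M hM x v y)
  rw [taylor_within_apply] at this
  simp only [one_smul, sub_zero, one_pow, mul_one, hk _ 0 (by simp : (0:ℝ) ∈ Set.Icc (0:ℝ) 1),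
    Complex.real_smul] at this
  refine (le_of_eq ?_).trans (this.trans (div_le_self ?_ ?_))
  · simp
  · exact (norm_nonneg _).trans (iter_bound (n + 1) g hg M hM x v 0)
  · exact_mod_cast Nat.one_le_iff_ne_zero.mpr (Nat.factorial_ne_zero n)

lemma conv_bound {d : ℕ} (n : ℕ) (g : Ed d → ℂ) (hg : ContDiff ℝ (⊤ : ℕ∞) g) (M : ℝ)
    (hM : ∀ L : List (Fin d), L.length = n + 1 → ∀ x, ‖Ds d L g x‖ ≤ M)
    (B : ℝ) (hB : ∀ x, ‖g x‖ ≤ B) (φ : SchwartzMap (Ed d) ℂ) (hφ : FVan φ) (x : Ed d) (c : ℝ) :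
    ‖∫ u, φ u * g (x + c • u)‖ ≤
      (∫ u, ‖u‖ ^ (n + 1) * ‖φ u‖) * ((d : ℝ) ^ (n + 1) * |c| ^ (n + 1) * M) := by
  have hm := fun k => moment c x k g hg φ hφ
  have hI : Integrable (fun u => φ u * g (x + c • u)) :=
    φ.integrable.mul_bdd (c := B) (by
      have : Continuous fun u : Ed d => g (x + c • u) := hg.continuous.comp (by fun_prop)
      exact this.aestronglyMeasurable) (Eventually.of_forall fun u => hB _)
  have hI2 : ∀ k ∈ Finset.range (n + 1), Integrable (fun u => ((k.factorial : ℝ)⁻¹ : ℂ) *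
      (φ u * iteratedDeriv k (fun t : ℝ => g (x + t • (c • u))) 0)) :=
    fun k _ => (hm k).1.const_mul _
  have e : ∫ u, φ u * g (x + c • u) = ∫ u, (φ u * g (x + c • u) -
      ∑ k ∈ Finset.range (n + 1), ((k.factorial : ℝ)⁻¹ : ℂ) *
      (φ u * iteratedDeriv k (fun t : ℝ => g (x + t • (c • u))) 0)) := by
    rw [integral_sub hI (integrable_finsetSum _ hI2), integral_finsetSum _ hI2]
    simp only [integral_const_mul, (hm _).2, mul_zero, Finset.sum_const_zero, sub_zero]
  rw [e, ← integral_mul_const]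
  refine norm_integral_le_of_norm_le ((φ.integrable_pow_mul volume (n + 1)).mul_const _)
    (Eventually.of_forall fun u => ?_)
  have := taylor_line n g hg M hM x (c • u)
  have e2 : φ u * g (x + c • u) - ∑ k ∈ Finset.range (n + 1), ((k.factorial : ℝ)⁻¹ : ℂ) *
      (φ u * iteratedDeriv k (fun t : ℝ => g (x + t • (c • u))) 0) =
      φ u * (g (x + c • u) - ∑ k ∈ Finset.range (n + 1), ((k.factorial : ℝ)⁻¹ : ℂ) *
      iteratedDeriv k (fun t : ℝ => g (x + t • (c • u))) 0) := by
    rw [mul_sub, Finset.mul_sum]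
    congr 1
    exact Finset.sum_congr rfl fun k _ => by ring
  rw [e2, norm_mul]
  refine (mul_le_mul_of_nonneg_left this (norm_nonneg _)).trans (le_of_eq ?_)
  rw [norm_smul, Real.norm_eq_abs]
  ring

lemma scale_bound (s r : ℝ) (k : ℕ) (h1 : 1 / 2 ≤ r) (h2 : r ≤ 2) :
    (1 + 2 ^ k * r) ^ s ≤ (4 : ℝ) ^ |s| * 2 ^ ((k : ℝ) * s) := by
  have hk : (1 : ℝ) ≤ 2 ^ k := one_le_pow₀ (by norm_num)
  have hk0 : (0 : ℝ) < 2 ^ k := by positivity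
  set c : ℝ := (1 + 2 ^ k * r) / 2 ^ k with hc
  have hc1 : 1 / 4 ≤ c := by rw [hc, le_div_iff₀ hk0]; nlinarith
  have hc2 : c ≤ 4 := by rw [hc, div_le_iff₀ hk0]; nlinarith
  have e : (1 + 2 ^ k * r) = c * 2 ^ k := by rw [hc]; field_simp
  rw [e, Real.mul_rpow (by linarith) hk0.le, Real.rpow_mul (by norm_num), Real.rpow_natCast]
  refine mul_le_mul_of_nonneg_right ?_ (by positivity)
  rcases le_total 0 s with hs | hs
  · rw [abs_of_nonneg hs]
    exact Real.rpow_le_rpow (by linarith) hc2 hs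
  · rw [abs_of_nonpos hs]
    have : (4 : ℝ) ^ (-s) = (1 / 4 : ℝ) ^ s := by
      rw [Real.rpow_neg (by norm_num), one_div, Real.inv_rpow (by norm_num)]
    rw [this]
    exact Real.rpow_le_rpow_of_nonpos (by norm_num) hc1 hs

/-- frequency-localized convolution estimate for symbols:
`|φ_j ∗ (∂_ξ^α a(·, 2^k ξ))(x)| ≤ C 2^{k(m-ρ|α|+ρN)} 2^{-jN}` for `|ξ| ∼ 1`. -/
theorem symbol_LP_convolution_decay (d : ℕ) (ρ m : ℝ) (hρ0 : 0 ≤ ρ) (hρ1 : ρ < 1)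
    (a : Ed d → Ed d → ℂ) (ha : IsSymbol d m ρ ρ a)
    (φ : SchwartzMap (Ed d) ℂ)
    (hφ : ∀ ξ : Ed d, (‖ξ‖ < 1/2 ∨ 2 < ‖ξ‖) → 𝓕 ⇑φ ξ = 0) :
    ∀ N : ℕ, 0 < N → ∀ α : List (Fin d), ∃ C : ℝ, ∀ j k : ℕ, 1 ≤ j →
      ∀ x ξ : Ed d, 1/2 ≤ ‖ξ‖ → ‖ξ‖ ≤ 2 →
      ‖∫ y : Ed d, (((2:ℝ) ^ (j * d) : ℝ) : ℂ) * φ ((2:ℝ) ^ (j:ℕ) • y) *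
          pdXis d α a (x - y) ((2:ℝ) ^ (k:ℕ) • ξ)‖ ≤
        C * (2:ℝ) ^ ((k:ℝ) * (m - ρ * α.length + ρ * N)) * (2:ℝ) ^ (-((j:ℝ) * N)) := by
  intro N hN α
  obtain ⟨n, rfl⟩ : ∃ n, N = n + 1 := ⟨N - 1, by omega⟩
  obtain ⟨hsm, hbd⟩ := ha
  have hsm' : Sm d a := hsm
  choose Cs hCs using hbd α
  have hfin : {L : List (Fin d) | L.length = n + 1}.Finite := List.finite_length_eq _ _
  set K : ℝ := ∑ L ∈ hfin.toFinset, |Cs L| with hK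
  have hKle : ∀ L : List (Fin d), L.length = n + 1 → Cs L ≤ K := fun L hL =>
    (le_abs_self _).trans (Finset.single_le_sum (f := fun L => |Cs L|)
      (fun _ _ => abs_nonneg _) (by simpa using hL))
  have hK0 : 0 ≤ K := Finset.sum_nonneg fun _ _ => abs_nonneg _
  have hvan : FVan φ := by
    filter_upwards [Metric.ball_mem_nhds (0 : Ed d) (by norm_num : (0 : ℝ) < 1 / 2)] with ξ hξ
    rw [SchwartzMap.fourier_coe]
    exact hφ ξ (Or.inl (by simpa using hξ))
  set s : ℝ := m - ρ * α.length + ρ * ((n + 1 : ℕ) : ℝ) with hs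
  set I : ℝ := ∫ u, ‖u‖ ^ (n + 1) * ‖φ u‖ with hI
  have hI0 : 0 ≤ I := integral_nonneg fun u => by positivity
  refine ⟨I * ((d : ℝ) ^ (n + 1) * (K * 4 ^ |s|)), fun j k hj x ξ h1 h2 => ?_⟩
  set η : Ed d := (2 : ℝ) ^ k • ξ with hη
  have hηn : ‖η‖ = 2 ^ k * ‖ξ‖ := by rw [hη, norm_smul]; simp
  set g : Ed d → ℂ := fun x => pdXis d α a x η with hg
  have hgs : ContDiff ℝ (⊤ : ℕ∞) g :=
    ContDiff.comp (Sm_pdXis hsm' α) (contDiff_id.prodMk contDiff_const)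
  have hM : ∀ L : List (Fin d), L.length = n + 1 → ∀ x, ‖Ds d L g x‖ ≤
      K * (4 ^ |s| * 2 ^ ((k : ℝ) * s)) := by
    intro L hL y
    rw [hg, ← pdXs_eq_Ds, pdXs_pdXis_comm hsm']
    refine (hCs L y η).trans ?_
    rw [hL, hηn]
    exact mul_le_mul (hKle L hL) (scale_bound s ‖ξ‖ k h1 h2) (by positivity) hK0
  have key := conv_bound n g hgs _ hM _ (fun y => hCs [] y η) φ hvan x (-((2 : ℝ) ^ j)⁻¹)
  have hcv : ∫ y : Ed d, (((2:ℝ) ^ (j * d) : ℝ) : ℂ) * φ ((2:ℝ) ^ (j:ℕ) • y) * g (x - y) =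
      ∫ u, φ u * g (x + (-((2 : ℝ) ^ j)⁻¹) • u) := by
    have h := Measure.integral_comp_smul (volume : Measure (Ed d))
      (fun u => φ u * g (x + (-((2 : ℝ) ^ j)⁻¹) • u)) ((2 : ℝ) ^ j)
    have hp : ((2 : ℝ) ^ j) ≠ 0 := by positivity
    simp only [smul_smul, neg_mul, inv_mul_cancel₀ hp, neg_smul, one_smul,
      ← sub_eq_add_neg, finrank_euclideanSpace, Fintype.card_fin] at h
    simp only [mul_assoc, neg_smul, ← sub_eq_add_neg]
    rw [integral_const_mul, h, abs_of_pos (by positivity), Complex.real_smul, ← mul_assoc,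
      ← Complex.ofReal_mul, pow_mul, mul_inv_cancel₀ (by positivity)]
    simp
  change ‖∫ y : Ed d, (((2:ℝ) ^ (j * d) : ℝ) : ℂ) * φ ((2:ℝ) ^ (j:ℕ) • y) * g (x - y)‖ ≤ _
  rw [hcv]
  refine key.trans (le_of_eq ?_)
  have e3 : (2:ℝ) ^ (-((j:ℝ) * ((n + 1 : ℕ) : ℝ))) = |(-((2 : ℝ) ^ j)⁻¹)| ^ (n + 1) := by
    rw [abs_neg, abs_of_pos (by positivity), Real.rpow_neg (by norm_num), inv_pow, ← pow_mul,
      ← Nat.cast_mul, Real.rpow_natCast]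
  rw [e3]
  ring
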